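/- Let G be the path on the ordered variable set V = {x_0, x_1, ..., x_n} with edges (x_i, x_{i+1}), 0 ≤ i ≤ n−1, let Φ = DS_G, and set y_i = x_0 + ... + x_i. For all nonnegative integers c_0, ..., c_n with c_0 + ... + c_n = n, Σ_{i=0}^{n} Φ( Π_{j=0}^{n} y_j^{c_{j+i}} ) = n!, where the index j+i in c is taken modulo n+1. -/

import Mathlib

open MvPolynomial

/-- Partial divided symmetrization of a polynomial `f` over the graph on the variables
`x_0 < x_1 < ... < x_{m-1}` whose (ordered) edges form the finset `E`:
`DS_G(f) = Σ_π (f ∘ π) / Π_{(x,y) ∈ E} (x_π − y_π)`,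
the sum being over all `m!` permutations of the variables. -/
noncomputable def DS {K : Type*} [Field K] {m : ℕ} (E : Finset (Fin m × Fin m))
    (f : MvPolynomial (Fin m) K) : FractionRing (MvPolynomial (Fin m) K) :=
  ∑ π : Equiv.Perm (Fin m),
    algebraMap (MvPolynomial (Fin m) K) (FractionRing (MvPolynomial (Fin m) K))
        (rename (⇑π) f) /
      algebraMap (MvPolynomial (Fin m) K) (FractionRing (MvPolynomial (Fin m) K))
        (rename (⇑π) (∏ e ∈ E, (X e.1 - X e.2)))

/-- The edge set of the path `x_0 — x_1 — ⋯ — x_n`: the pairs `(x_i, x_{i+1})`,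
`0 ≤ i ≤ n−1`. -/
def pathEdges (n : ℕ) : Finset (Fin (n + 1) × Fin (n + 1)) :=
  Finset.univ.image fun i : Fin n => (i.castSucc, i.succ)

/-- `pathY n K k = y_k = x_0 + x_1 + ⋯ + x_k`. -/
noncomputable def pathY (n : ℕ) (K : Type*) [Field K] (k : Fin (n + 1)) :
    MvPolynomial (Fin (n + 1)) K :=
  ∑ j ∈ Finset.Iic k, X j

/-- The pairs `i < j` lying in the same block (fibre) of `b`. -/
def blockPairs {m : ℕ} (b : Fin m → ℕ) : Finset (Fin m × Fin m) :=
  Finset.univ.filter fun p => p.1 < p.2 ∧ b p.1 = b p.2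

/-- The permutations preserving every block (fibre) of `b`. -/
def blockPerms {m : ℕ} (b : Fin m → ℕ) : Finset (Equiv.Perm (Fin m)) :=
  Finset.univ.filter fun π => ∀ i, b (π i) = b i

theorem card_blockPairs_le_sum {m : ℕ} (b d : Fin m → ℕ)
    (hd : ∀ i j, b i = b j → d i = d j → i = j) :
    (blockPairs b).card ≤ ∑ i, d i := by
  classical
  let T : Finset (Fin m × Fin m) :=
    Finset.univ.filter fun p => d p.2 < d p.1 ∧ b p.1 = b p.2
  have h1 : (blockPairs b).card ≤ T.card := by
    refine Finset.card_le_card_of_injOn (fun p => if d p.2 < d p.1 then p else p.swap) ?_ ?_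
    · rintro ⟨i, j⟩ hp
      simp only [blockPairs, Finset.coe_filter, Finset.mem_univ, true_and, Set.mem_ofPred_eq,
        T] at hp ⊢
      have := hd i j hp.2
      split_ifs with h
      · exact ⟨h, hp.2⟩
      · refine ⟨lt_of_le_of_ne (not_lt.mp h) fun h' => ?_, hp.2.symm⟩
        exact absurd (this h') hp.1.ne
    · rintro ⟨i, j⟩ hp ⟨k, l⟩ hq h
      simp only [blockPairs, Finset.coe_filter, Finset.mem_univ, true_and,
        Set.mem_ofPred_eq] at hp hq
      dsimp only at h
      split_ifs at h <;> simp only [Prod.swap_prod_mk, Prod.mk.injEq] at h ⊢ <;> omega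
  have h2 : T.card = ∑ i, (T.filter fun p => p.1 = i).card :=
    Finset.card_eq_sum_card_fiberwise fun _ _ => Finset.mem_coe.mpr (Finset.mem_univ _)
  refine h1.trans (h2.trans_le (Finset.sum_le_sum fun i _ => ?_))
  rw [← Finset.card_range (d i)]
  refine Finset.card_le_card_of_injOn (fun p => d p.2) ?_ ?_
  · rintro ⟨k, l⟩ hp
    simp only [Finset.coe_filter, T, Finset.mem_filter, Finset.mem_univ, true_and,
      Set.mem_ofPred_eq, Finset.coe_range, Set.mem_Iio] at hp ⊢
    rw [← hp.2]
    exact hp.1.1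
  · rintro ⟨k, l⟩ hp ⟨k', l'⟩ hq h
    simp only [Finset.coe_filter, T, Finset.mem_filter, Finset.mem_univ, true_and,
      Set.mem_ofPred_eq] at hp hq h
    have hk : k = k' := hp.2.trans hq.2.symm
    subst hk
    rw [hd l l' (hp.1.2.symm.trans hq.1.2) h]

/-- Antisymmetrization over the block permutations kills polynomials of small degree. -/
theorem sum_sign_rename_eq_zero {K : Type*} [Field K] [CharZero K] {m : ℕ} (b : Fin m → ℕ)
    (p : MvPolynomial (Fin m) K) (hp : p.totalDegree < (blockPairs b).card) :
    ∑ h ∈ blockPerms b,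
      ((Equiv.Perm.sign h : ℤ) : MvPolynomial (Fin m) K) * rename (⇑h) p = 0 := by
  classical
  set A := ∑ h ∈ blockPerms b,
    ((Equiv.Perm.sign h : ℤ) : MvPolynomial (Fin m) K) * rename (⇑h) p with hA
  have hanti : ∀ i j, i ≠ j → b i = b j → rename (⇑(Equiv.swap i j)) A = -A := by
    intro i j hij hb
    have hsw : ∀ a, b (Equiv.swap i j a) = b a := by
      intro a
      by_cases h1 : a = i
      · simp [h1, hb]
      by_cases h2 : a = j
      · simp [h2, hb]
      rw [Equiv.swap_apply_of_ne_of_ne h1 h2]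
    rw [hA, map_sum, ← Finset.sum_neg_distrib]
    refine Finset.sum_bij' (fun h _ => Equiv.swap i j * h) (fun h _ => Equiv.swap i j * h)
      ?_ ?_ ?_ ?_ ?_
    · intro h hh
      simpa [blockPerms, hsw] using hh
    · intro h hh
      simpa [blockPerms, hsw] using hh
    · intro h _
      simp [← mul_assoc]
    · intro h _
      simp [← mul_assoc]
    · intro h _
      rw [map_mul, map_intCast, rename_rename, Equiv.Perm.sign_mul, Equiv.Perm.sign_swap hij,
        Equiv.Perm.coe_mul]
      simp
  have hdeg : A.totalDegree ≤ p.totalDegree := by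
    refine totalDegree_finsetSum_le fun h _ => ?_
    refine (totalDegree_mul _ _).trans ?_
    rw [← map_intCast (C : K →+* MvPolynomial (Fin m) K), totalDegree_C, zero_add]
    exact totalDegree_rename_le _ _
  by_contra hne
  obtain ⟨d, hd⟩ := MvPolynomial.ne_zero_iff.mp hne
  have hinj : ∀ i j, b i = b j → d i = d j → i = j := by
    intro i j hb hdij
    by_contra hij
    have h1 := coeff_rename_mapDomain _ (Equiv.swap i j).injective A d
    have h2 : Finsupp.mapDomain (⇑(Equiv.swap i j)) d = d := by
      ext a
      rw [Finsupp.mapDomain_equiv_apply, Equiv.symm_swap]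
      by_cases h1 : a = i
      · simp [h1, hdij]
      by_cases h2 : a = j
      · simp [h2, hdij]
      rw [Equiv.swap_apply_of_ne_of_ne h1 h2]
    rw [h2, hanti i j hij hb, coeff_neg] at h1
    exact hd (self_eq_neg.mp h1.symm)
  have h3 := card_blockPairs_le_sum b d hinj
  have h4 := le_totalDegree (mem_support_iff.mpr hd)
  rw [Finsupp.sum_fintype _ _ (fun _ => rfl)] at h4
  omega

theorem rename_prod_blockPairs {K : Type*} [Field K] {m : ℕ} (b : Fin m → ℕ) (hb : Monotone b)
    (h : Equiv.Perm (Fin m)) (hh : h ∈ blockPerms b) :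
    rename (⇑h) (∏ e ∈ blockPairs b, (X e.1 - X e.2 : MvPolynomial (Fin m) K)) =
      ((Equiv.Perm.sign h : ℤ) : MvPolynomial (Fin m) K) *
        ∏ e ∈ blockPairs b, (X e.1 - X e.2) := by
  classical
  let W : Finset (Fin m × Fin m) := Finset.univ.filter fun p => b p.1 < b p.2
  let F : Fin m × Fin m → MvPolynomial (Fin m) K := fun e => X e.1 - X e.2
  have hh' : ∀ i, b (h i) = b i := by simpa [blockPerms] using hh
  have hfull : ∀ f : Fin m × Fin m → MvPolynomial (Fin m) K,
      (∏ e ∈ blockPairs b, f e) * ∏ e ∈ W, f e = ∏ i, ∏ j ∈ Finset.Ioi i, f (i, j) := by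
    intro f
    rw [← Finset.prod_union, Finset.prod_sigma']
    · refine Finset.prod_bij' (fun e _ => ⟨e.1, e.2⟩) (fun e _ => (e.1, e.2)) ?_ ?_ ?_ ?_ ?_
      · rintro ⟨i, j⟩ he
        simp only [blockPairs, W, Finset.mem_union, Finset.mem_filter, Finset.mem_univ,
          true_and] at he
        simp only [Finset.mem_sigma, Finset.mem_univ, Finset.mem_Ioi, true_and]
        exact he.elim (fun h => h.1) fun h => hb.reflect_lt h
      · rintro ⟨i, j⟩ he
        simp only [Finset.mem_sigma, Finset.mem_univ, Finset.mem_Ioi, true_and] at he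
        simp only [blockPairs, W, Finset.mem_union, Finset.mem_filter, Finset.mem_univ,
          true_and]
        have := hb he.le
        omega
      all_goals simp
    · rw [Finset.disjoint_left]
      rintro ⟨i, j⟩ h1 h2
      simp only [blockPairs, W, Finset.mem_filter, Finset.mem_univ, true_and] at h1 h2
      omega
  have hW : rename (⇑h) (∏ e ∈ W, F e) = ∏ e ∈ W, F e := by
    rw [map_prod]
    refine Finset.prod_bij' (fun e _ => (h e.1, h e.2)) (fun e _ => (h⁻¹ e.1, h⁻¹ e.2))
      ?_ ?_ ?_ ?_ ?_
    · rintro ⟨i, j⟩ he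
      simpa [W, hh'] using he
    · rintro ⟨i, j⟩ he
      have h1 := hh' (h.symm i)
      have h2 := hh' (h.symm j)
      rw [h.apply_symm_apply] at h1 h2
      simp only [W, Finset.mem_filter, Finset.mem_univ, true_and, Equiv.Perm.inv_def] at he ⊢
      rwa [← h1, ← h2]
    all_goals simp [F]
  have hW0 : (∏ e ∈ W, F e) ≠ 0 := by
    refine Finset.prod_ne_zero_iff.mpr fun e he => ?_
    have he' : b e.1 < b e.2 := by simpa [W] using he
    refine sub_ne_zero.mpr fun hX => ?_
    rw [X_injective hX] at he'
    exact lt_irrefl _ he'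
  refine mul_right_cancel₀ hW0 ?_
  rw [mul_assoc, hfull F, ← hW, ← map_mul]
  change rename (⇑h) ((∏ e ∈ blockPairs b, F e) * _) = _
  rw [hfull F, ← Equiv.Perm.prod_Ioi_comp_eq_sign_mul_prod h (f := fun i j => F (i, j))
    (fun i j => by simp [F])]
  simp [F, map_prod]

theorem card_mul_DS {K : Type*} [Field K] {m : ℕ} {ι : Type*} (s : Finset ι)
    (h : ι → Equiv.Perm (Fin m)) (E : Finset (Fin m × Fin m)) (f : MvPolynomial (Fin m) K) :
    (s.card : FractionRing (MvPolynomial (Fin m) K)) * DS E f =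
      ∑ π : Equiv.Perm (Fin m), ∑ i ∈ s,
        algebraMap (MvPolynomial (Fin m) K) (FractionRing (MvPolynomial (Fin m) K))
            (rename (⇑(π * h i)) f) /
          algebraMap (MvPolynomial (Fin m) K) (FractionRing (MvPolynomial (Fin m) K))
            (rename (⇑(π * h i)) (∏ e ∈ E, (X e.1 - X e.2))) := by
  rw [Finset.sum_comm, ← nsmul_eq_mul, ← Finset.sum_const]
  refine Finset.sum_congr rfl fun i _ => ?_
  exact (Equiv.sum_comp (Equiv.mulRight (h i)) fun π : Equiv.Perm (Fin m) =>
    algebraMap (MvPolynomial (Fin m) K) (FractionRing (MvPolynomial (Fin m) K))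
        (rename (⇑π) f) /
      algebraMap (MvPolynomial (Fin m) K) (FractionRing (MvPolynomial (Fin m) K))
        (rename (⇑π) (∏ e ∈ E, (X e.1 - X e.2)))).symm

/-- If all edges stay inside blocks of `b` and `g` has degree below `#E`, then the
divided symmetrization of `u * g` vanishes for each block-symmetric `u`. -/
theorem DS_mul_eq_zero {K : Type*} [Field K] [CharZero K] {m : ℕ} (b : Fin m → ℕ)
    (hb : Monotone b) (E : Finset (Fin m × Fin m)) (hE : E ⊆ blockPairs b)
    (u g : MvPolynomial (Fin m) K) (hu : ∀ h ∈ blockPerms b, rename (⇑h) u = u)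
    (hg : g.totalDegree < E.card) : DS E (u * g) = 0 := by
  classical
  let R := MvPolynomial (Fin m) K
  let L := FractionRing R
  let F : Fin m × Fin m → R := fun e => X e.1 - X e.2
  let Q : R := ∏ e ∈ blockPairs b \ E, F e
  let V : R := ∏ e ∈ blockPairs b, F e
  have hV : Q * ∏ e ∈ E, F e = V := Finset.prod_sdiff hE
  have hV0 : V ≠ 0 := by
    refine Finset.prod_ne_zero_iff.mpr fun e he => ?_
    have he' : e.1 < e.2 := by
      simp only [blockPairs, Finset.mem_filter] at he
      exact he.2.1
    exact sub_ne_zero.mpr fun hX => he'.ne (X_injective hX)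
  have hQ0 : Q ≠ 0 := left_ne_zero_of_mul (hV.trans_ne hV0)
  have hQ : Q.totalDegree ≤ (blockPairs b).card - E.card := by
    rw [← Finset.card_sdiff_of_subset hE]
    refine (totalDegree_finsetProd _ _).trans ?_
    refine (Finset.sum_le_card_nsmul _ _ 1 fun e _ => ?_).trans (by simp)
    refine (totalDegree_sub _ _).trans ?_
    simp
  have hcard := Finset.card_le_card hE
  have hA := sum_sign_rename_eq_zero b (g * Q) (by
    have := totalDegree_mul g Q
    omega)
  have hone : (1 : Equiv.Perm (Fin m)) ∈ blockPerms b := by simp [blockPerms]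
  have key := card_mul_DS (blockPerms b) (fun h => h) E (u * g)
  have hcard0 : ((blockPerms b).card : L) ≠ 0 :=
    Nat.cast_ne_zero.mpr (Finset.card_ne_zero_of_mem hone)
  refine (mul_eq_zero.mp (key.trans ?_)).resolve_left hcard0
  refine Finset.sum_eq_zero fun π _ => ?_
  have hterm : ∀ h ∈ blockPerms b,
      algebraMap R L (rename (⇑(π * h)) (u * g)) /
          algebraMap R L (rename (⇑(π * h)) (∏ e ∈ E, F e)) =
        algebraMap R L (rename (⇑π) u) / algebraMap R L (rename (⇑π) V) *
          algebraMap R L (rename (⇑π)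
            (((Equiv.Perm.sign h : ℤ) : R) * rename (⇑h) (g * Q))) := by
    intro h hh
    have hinj : ∀ σ : Equiv.Perm (Fin m), ∀ q : R, q ≠ 0 →
        algebraMap R L (rename (⇑σ) q) ≠ 0 := fun σ q hq =>
      (map_ne_zero_iff _ (IsFractionRing.injective R L)).mpr
        ((map_ne_zero_iff _ (rename_injective _ σ.injective)).mpr hq)
    have hcomp : ∀ q : R, rename (⇑(π * h)) q = rename (⇑π) (rename (⇑h) q) := fun q => by
      rw [rename_rename, Equiv.Perm.coe_mul]
    have hsq : ((Equiv.Perm.sign h : ℤ) : R) * ((Equiv.Perm.sign h : ℤ) : R) = 1 := by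
      rw [← Int.cast_mul, ← Units.val_mul, Int.units_mul_self, Units.val_one, Int.cast_one]
    have hVh : rename (⇑π) (rename (⇑h) Q) * rename (⇑π) (rename (⇑h) (∏ e ∈ E, F e)) =
        ((Equiv.Perm.sign h : ℤ) : R) * rename (⇑π) V := by
      rw [← map_mul, ← map_mul, hV, rename_prod_blockPairs b hb h hh, map_mul, map_intCast]
    have h0 := hinj (π * h) (∏ e ∈ E, F e) (right_ne_zero_of_mul (hV.trans_ne hV0))
    rw [div_mul_eq_mul_div, div_eq_div_iff h0 (hinj π V hV0)]
    simp only [← map_mul]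
    congr 1
    simp only [hcomp, map_mul, map_intCast, hu h hh]
    linear_combination (rename (⇑π) u) * rename (⇑π) (rename (⇑h) g) *
      (-(rename (⇑π) V) * hsq - ((Equiv.Perm.sign h : ℤ) : R) * hVh)
  rw [Finset.sum_congr rfl hterm, ← Finset.mul_sum, ← map_sum, ← map_sum, hA]
  simp

theorem DS_add {K : Type*} [Field K] {m : ℕ} (E : Finset (Fin m × Fin m))
    (f g : MvPolynomial (Fin m) K) : DS E (f + g) = DS E f + DS E g := by
  simp only [DS, map_add, add_div, Finset.sum_add_distrib]

theorem DS_edge_mul {K : Type*} [Field K] {m : ℕ} (E : Finset (Fin m × Fin m))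
    (e : Fin m × Fin m) (he : e ∈ E) (hne : e.1 ≠ e.2) (f : MvPolynomial (Fin m) K) :
    DS E ((X e.1 - X e.2) * f) = DS (E.erase e) f := by
  refine Finset.sum_congr rfl fun π _ => ?_
  rw [← Finset.mul_prod_erase E _ he]
  simp only [map_mul]
  refine mul_div_mul_left _ _ ((map_ne_zero_iff _ (IsFractionRing.injective _ _)).mpr
    ((map_ne_zero_iff _ (rename_injective _ π.injective)).mpr ?_))
  exact sub_ne_zero.mpr fun hX => hne (X_injective hX)

theorem totalDegree_pathY_le (n : ℕ) (K : Type*) [Field K] (k : Fin (n + 1)) :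
    (pathY n K k).totalDegree ≤ 1 :=
  totalDegree_finsetSum_le fun i _ => by simp

theorem pathY_zero (n : ℕ) (K : Type*) [Field K] : pathY n K 0 = X 0 := by
  have : Finset.Iic (0 : Fin (n + 1)) = {0} := by
    ext i
    simp
  rw [pathY, this, Finset.sum_singleton]

theorem pathY_succ (n : ℕ) (K : Type*) [Field K] (k : Fin n) :
    pathY n K k.succ = pathY n K k.castSucc + X k.succ := by
  have : Finset.Iic k.succ = insert k.succ (Finset.Iic k.castSucc) := by
    ext i
    simp only [Finset.mem_insert, Finset.mem_Iic, Fin.le_def, Fin.ext_iff, Fin.val_succ,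
      Fin.val_castSucc]
    omega
  unfold pathY
  rw [this, Finset.sum_insert (by simp)]
  exact add_comm _ _

/-- The block labelling separating the vertices up to `k` from those after `k`. -/
def cutAt {m : ℕ} (k i : Fin m) : ℕ := if i ≤ k then 0 else 1

theorem monotone_cutAt {m : ℕ} (k : Fin m) : Monotone (cutAt k) := by
  intro i j hij
  unfold cutAt
  split_ifs with h1 h2 <;> omega

theorem rename_pathY_of_mem_blockPerms (n : ℕ) (K : Type*) [Field K] (k : Fin (n + 1))
    (h : Equiv.Perm (Fin (n + 1))) (hh : h ∈ blockPerms (cutAt k)) :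
    rename (⇑h) (pathY n K k) = pathY n K k := by
  have hh' : ∀ i, h i ≤ k ↔ i ≤ k := by
    intro i
    have := (Finset.mem_filter.mp hh).2 i
    unfold cutAt at this
    split_ifs at this <;> omega
  rw [pathY, map_sum]
  exact Finset.sum_equiv h (fun i => by simp [hh']) fun i _ => rename_X _ _

theorem mem_pathEdges (n : ℕ) (k : Fin n) : (k.castSucc, k.succ) ∈ pathEdges n :=
  Finset.mem_image_of_mem (fun i : Fin n => (i.castSucc, i.succ)) (Finset.mem_univ k)

theorem card_pathEdges (n : ℕ) : (pathEdges n).card = n := by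
  rw [pathEdges, Finset.card_image_of_injective _ fun i j hij => ?_]
  · simp
  · exact Fin.castSucc_injective _ (congrArg Prod.fst hij)

/-- `Φ` of a multiple of the symmetric polynomial `y_n` by a polynomial of degree below `n`. -/
theorem DS_pathEdges_pathY_last_mul {K : Type*} [Field K] [CharZero K] (n : ℕ)
    (f : MvPolynomial (Fin (n + 1)) K) (hf : f.totalDegree < n) :
    DS (pathEdges n) (pathY n K (Fin.last n) * f) = 0 := by
  refine DS_mul_eq_zero _ (monotone_cutAt (Fin.last n)) _ ?_ _ _
    (rename_pathY_of_mem_blockPerms n K _) (hf.trans_eq (card_pathEdges n).symm)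
  intro e he
  obtain ⟨i, -, rfl⟩ := Finset.mem_image.mp he
  simp [blockPairs, cutAt, Fin.le_last]

theorem DS_erase_pathY_mul {K : Type*} [Field K] [CharZero K] (n : ℕ) (k : Fin n)
    (f : MvPolynomial (Fin (n + 1)) K) (hf : f.totalDegree + 1 < n) :
    DS ((pathEdges n).erase (k.castSucc, k.succ)) (pathY n K k.castSucc * f) = 0 := by
  refine DS_mul_eq_zero _ (monotone_cutAt k.castSucc) _ ?_ _ _
    (rename_pathY_of_mem_blockPerms n K _) ?_
  · intro e he
    obtain ⟨hne, he⟩ := Finset.mem_erase.mp he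
    obtain ⟨i, -, rfl⟩ := Finset.mem_image.mp he
    have hik : i ≠ k := fun h => hne (by rw [h])
    simp only [blockPairs, cutAt, Finset.mem_filter, Finset.mem_univ, true_and, Fin.le_def,
      Fin.lt_def, Fin.val_castSucc, Fin.val_succ]
    have hv : i.val ≠ k.val := fun h => hik (Fin.ext h)
    refine ⟨by omega, ?_⟩
    split_ifs <;> omega
  · have := Finset.card_erase_of_mem (mem_pathEdges n k)
    rw [card_pathEdges] at this
    omega

/-- Deleting an edge of the path as a second difference in `y` (with cyclic indices). -/
theorem two_mul_DS_pathY_mul {K : Type*} [Field K] [CharZero K] (n : ℕ) (k : Fin n)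
    (f : MvPolynomial (Fin (n + 1)) K) (hf : f.totalDegree < n) :
    2 * DS (pathEdges n) (pathY n K k.castSucc * f) =
      DS (pathEdges n) (pathY n K (k.castSucc - 1) * f) +
        DS (pathEdges n) (pathY n K (k.castSucc + 1) * f) +
        DS ((pathEdges n).erase (k.castSucc, k.succ)) f := by
  have hstep : k.castSucc + 1 = k.succ := Fin.coeSucc_eq_succ
  have hX : DS (pathEdges n) (X k.castSucc * f) + DS (pathEdges n) (pathY n K (k.castSucc - 1) * f)
      = DS (pathEdges n) (pathY n K k.castSucc * f) := by
    obtain ⟨m, rfl⟩ : ∃ m, n = m + 1 := ⟨n - 1, by have := k.isLt; omega⟩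
    rcases Fin.eq_zero_or_eq_succ k with rfl | ⟨j, rfl⟩
    · have hlast : (0 : Fin (m + 1)).castSucc - 1 = Fin.last (m + 1) := by
        rw [sub_eq_iff_eq_add, Fin.last_add_one, Fin.castSucc_zero]
      rw [hlast, DS_pathEdges_pathY_last_mul _ _ hf, add_zero, Fin.castSucc_zero, pathY_zero]
    · have hpred : j.succ.castSucc - 1 = j.castSucc.castSucc := by
        rw [sub_eq_iff_eq_add, Fin.coeSucc_eq_succ, Fin.succ_castSucc]
      rw [hpred, ← Fin.succ_castSucc, pathY_succ, add_mul, DS_add]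
      exact add_comm _ _
  have hedge := DS_edge_mul (pathEdges n) (k.castSucc, k.succ)
    (mem_pathEdges n k) (Fin.castSucc_lt_succ).ne f
  have hsplit : DS (pathEdges n) ((X k.castSucc - X k.succ) * f) +
      DS (pathEdges n) (pathY n K (k.castSucc + 1) * f) =
      DS (pathEdges n) (X k.castSucc * f) + DS (pathEdges n) (pathY n K k.castSucc * f) := by
    rw [← DS_add, ← DS_add, hstep, pathY_succ]
    congr 1
    ring
  dsimp only at hedge
  linear_combination -hX - hsplit + hedge

/-- The discrete harmonicity of `Φ` on `y`-monomials, with cyclic indices. -/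
theorem two_mul_DS_pathY_mul_pathY_mul {K : Type*} [Field K] [CharZero K] (n : ℕ)
    (k : Fin (n + 1)) (g : MvPolynomial (Fin (n + 1)) K) (hg : g.totalDegree + 1 < n) :
    2 * DS (pathEdges n) (pathY n K k * (pathY n K k * g)) =
      DS (pathEdges n) (pathY n K (k - 1) * (pathY n K k * g)) +
        DS (pathEdges n) (pathY n K (k + 1) * (pathY n K k * g)) := by
  have hdeg : ∀ j, (pathY n K j * g).totalDegree < n := fun j => by
    have h1 := totalDegree_mul (pathY n K j) g
    have h2 := totalDegree_pathY_le n K j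
    omega
  induction k using Fin.lastCases with
  | last =>
    rw [mul_left_comm (pathY n K (Fin.last n - 1)), mul_left_comm (pathY n K (Fin.last n + 1))]
    simp only [DS_pathEdges_pathY_last_mul _ _ (hdeg _), mul_zero, add_zero]
  | cast k =>
    rw [two_mul_DS_pathY_mul n k _ (hdeg _), DS_erase_pathY_mul n k g hg, add_zero]

/-- Deleting the last edge from the path isolates the last vertex. -/
theorem DS_erase_last_edge {K : Type*} [Field K] [CharZero K] (n : ℕ)
    (g : MvPolynomial (Fin (n + 1)) K) (N : ℕ) (hN : DS (pathEdges n) g = N) :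
    DS ((pathEdges (n + 1)).erase ((Fin.last n).castSucc, (Fin.last n).succ))
      (rename Fin.castSucc g) = ((n + 2) * N : ℕ) := by
  classical
  let L := FractionRing (MvPolynomial (Fin (n + 2)) K)
  let ext : Equiv.Perm (Fin (n + 1)) → Equiv.Perm (Fin (n + 2)) :=
    fun h => h.viaFintypeEmbedding Fin.castSuccEmb
  have hext : ∀ h, ⇑(ext h) ∘ Fin.castSucc = Fin.castSucc ∘ ⇑h := fun h => by
    ext1 i
    exact h.viaFintypeEmbedding_apply_image Fin.castSuccEmb i
  have hE : ∏ e ∈ (pathEdges (n + 1)).erase ((Fin.last n).castSucc, (Fin.last n).succ),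
      (X e.1 - X e.2 : MvPolynomial (Fin (n + 2)) K) =
      rename Fin.castSucc (∏ e ∈ pathEdges n, (X e.1 - X e.2)) := by
    have : (pathEdges (n + 1)).erase ((Fin.last n).castSucc, (Fin.last n).succ) =
        (pathEdges n).image (Prod.map Fin.castSucc Fin.castSucc) := by
      ext ⟨i, j⟩
      simp only [pathEdges, Finset.mem_erase, Finset.mem_image, Finset.mem_univ, true_and,
        Prod.mk.injEq, ne_eq, exists_exists_eq_and, Prod.map_apply]
      constructor
      · rintro ⟨hne, k, rfl, rfl⟩
        induction k using Fin.lastCases with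
        | last => exact absurd ⟨rfl, rfl⟩ hne
        | cast k => exact ⟨k, rfl, Fin.succ_castSucc k⟩
      · rintro ⟨k, rfl, rfl⟩
        refine ⟨fun h => ?_, k.castSucc, rfl, (Fin.succ_castSucc k)⟩
        exact (Fin.castSucc_lt_last k).ne (Fin.castSucc_injective _ h.1)
    rw [this, Finset.prod_image
      ((Fin.castSucc_injective _).prodMap (Fin.castSucc_injective _)).injOn, map_prod]
    simp
  have key := card_mul_DS (Finset.univ) ext
    ((pathEdges (n + 1)).erase ((Fin.last n).castSucc, (Fin.last n).succ))
    (rename Fin.castSucc g)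
  have hinner : ∀ π : Equiv.Perm (Fin (n + 2)), ∑ h : Equiv.Perm (Fin (n + 1)),
      algebraMap (MvPolynomial (Fin (n + 2)) K) L
          (rename (⇑(π * ext h)) (rename Fin.castSucc g)) /
        algebraMap (MvPolynomial (Fin (n + 2)) K) L
          (rename (⇑(π * ext h))
            (∏ e ∈ (pathEdges (n + 1)).erase ((Fin.last n).castSucc, (Fin.last n).succ),
              (X e.1 - X e.2))) = N := by
    intro π
    let j : MvPolynomial (Fin (n + 1)) K →+* L :=
      (algebraMap (MvPolynomial (Fin (n + 2)) K) L).comp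
        (rename (⇑π ∘ Fin.castSucc)).toRingHom
    have hj : Function.Injective j :=
      (IsFractionRing.injective _ L).comp
        (rename_injective _ (π.injective.comp (Fin.castSucc_injective _)))
    have hjren : ∀ (h : Equiv.Perm (Fin (n + 1))) (q : MvPolynomial (Fin (n + 1)) K),
        algebraMap (MvPolynomial (Fin (n + 2)) K) L
          (rename (⇑(π * ext h)) (rename Fin.castSucc q)) = j (rename (⇑h) q) := by
      intro h q
      change _ = algebraMap (MvPolynomial (Fin (n + 2)) K) L
        (rename (⇑π ∘ Fin.castSucc) (rename (⇑h) q))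
      rw [rename_rename, rename_rename, Equiv.Perm.coe_mul, Function.comp_assoc, hext,
        Function.comp_assoc]
    have := congrArg (IsFractionRing.lift
      (K := FractionRing (MvPolynomial (Fin (n + 1)) K)) hj) hN
    rw [DS, map_sum, map_natCast] at this
    rw [← this, hE]
    refine Finset.sum_congr rfl fun h _ => ?_
    rw [hjren, hjren, map_div₀, IsFractionRing.lift_algebraMap, IsFractionRing.lift_algebraMap]
  rw [Finset.sum_congr rfl fun π _ => hinner π, Finset.sum_const, Finset.card_univ,
    Finset.card_univ, Fintype.card_perm, Fintype.card_perm, Fintype.card_fin, Fintype.card_fin,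
    nsmul_eq_mul, Nat.factorial_succ (n + 1)] at key
  have h0 : (((n + 1).factorial : ℕ) : L) ≠ 0 := Nat.cast_ne_zero.mpr (Nat.factorial_ne_zero _)
  refine mul_left_cancel₀ h0 (key.trans ?_)
  push_cast
  ring

/-- `Φ(y_0 y_1 ⋯ y_{n-1}) = n!`. -/
theorem DS_pathEdges_prod_pathY {K : Type*} [Field K] [CharZero K] (n : ℕ) :
    DS (pathEdges n) (∏ i : Fin n, pathY n K i.castSucc) =
      (n.factorial : FractionRing (MvPolynomial (Fin (n + 1)) K)) := by
  induction n with
  | zero => simp [DS, pathEdges]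
  | succ n ih =>
    let h : MvPolynomial (Fin (n + 2)) K := ∏ i : Fin n, pathY (n + 1) K i.castSucc.castSucc
    have hren : h = rename Fin.castSucc (∏ i : Fin n, pathY n K i.castSucc) := by
      rw [map_prod]
      refine Finset.prod_congr rfl fun i _ => ?_
      rw [pathY, pathY, map_sum, ← Fin.map_castSuccEmb_Iic, Finset.sum_map]
      simp
    have hdeg : ∀ s : Finset (Fin n),
        (∏ i ∈ s, pathY (n + 1) K i.castSucc.castSucc).totalDegree ≤ s.card := fun s =>
      (totalDegree_finsetProd _ _).trans
        ((Finset.sum_le_card_nsmul _ _ 1 fun i _ => totalDegree_pathY_le _ _ _).trans (by simp))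
    have hh : h.totalDegree < n + 1 := by
      have := hdeg Finset.univ
      rw [Finset.card_univ, Fintype.card_fin] at this
      exact Nat.lt_succ_of_le this
    have hsucc : ∀ j : ℕ, Fin.ofNat (n + 2) (j + 1) = Fin.ofNat (n + 2) j + 1 := fun j => by
      ext
      simp [Fin.val_add]
    let a : ℕ → FractionRing (MvPolynomial (Fin (n + 2)) K) :=
      fun j => DS (pathEdges (n + 1)) (pathY (n + 1) K (Fin.ofNat (n + 2) j - 1) * h)
    have hlast : ∀ j : ℕ, Fin.ofNat (n + 2) j = 0 → a j = 0 := by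
      intro j hj
      have : Fin.ofNat (n + 2) j - 1 = Fin.last (n + 1) := by
        rw [hj, sub_eq_iff_eq_add, Fin.last_add_one]
      simp only [a, this]
      exact DS_pathEdges_pathY_last_mul _ _ hh
    have hrec : ∀ j : ℕ, j < n → 2 * a (j + 1) = a j + a (j + 2) := by
      intro j hj
      have hcast : Fin.ofNat (n + 2) j = (⟨j, hj⟩ : Fin n).castSucc.castSucc := by
        ext
        simp only [Fin.val_ofNat, Fin.val_castSucc]
        exact Nat.mod_eq_of_lt (by omega)
      have hprod : h = pathY (n + 1) K (Fin.ofNat (n + 2) j) *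
          ∏ i ∈ Finset.univ.erase (⟨j, hj⟩ : Fin n), pathY (n + 1) K i.castSucc.castSucc := by
        rw [hcast]
        exact (Finset.mul_prod_erase _ (fun i : Fin n => pathY (n + 1) K i.castSucc.castSucc)
          (Finset.mem_univ _)).symm
      have hd := hdeg (Finset.univ.erase ⟨j, hj⟩)
      rw [Finset.card_erase_of_mem (Finset.mem_univ _), Finset.card_univ, Fintype.card_fin] at hd
      have := two_mul_DS_pathY_mul_pathY_mul (K := K) (n + 1) (Fin.ofNat (n + 2) j)
        (∏ i ∈ Finset.univ.erase (⟨j, hj⟩ : Fin n), pathY (n + 1) K i.castSucc.castSucc) (by omega)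
      rw [← hprod] at this
      have e1 : Fin.ofNat (n + 2) (j + 1) - 1 = Fin.ofNat (n + 2) j := by
        rw [hsucc, add_sub_cancel_right]
      have e2 : Fin.ofNat (n + 2) (j + 2) - 1 = Fin.ofNat (n + 2) j + 1 := by
        rw [hsucc, add_sub_cancel_right, hsucc]
      simp only [a, e1, e2]
      exact this
    have hlin : ∀ j : ℕ, j ≤ n → a j = j * a 1 ∧ a (j + 1) = (j + 1) * a 1 := by
      intro j
      induction j with
      | zero => exact fun _ => ⟨by simp [hlast 0 (by simp)], by simp⟩
      | succ j ihj =>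
        intro hj
        obtain ⟨h1, h2⟩ := ihj (by omega)
        have := hrec j (by omega)
        refine ⟨by rw [h2]; push_cast; ring, ?_⟩
        push_cast
        linear_combination -this + 2 * h2 - h1
    obtain ⟨h1, h2⟩ := hlin n le_rfl
    have hend := two_mul_DS_pathY_mul (K := K) (n + 1) (Fin.last n) h hh
    have hcast : (Fin.last n).castSucc = Fin.ofNat (n + 2) (n + 1) - 1 := by
      rw [eq_sub_iff_add_eq, Fin.coeSucc_eq_succ, Fin.succ_last]
      ext
      simp
    have hm1 : (Fin.last n).castSucc - 1 = Fin.ofNat (n + 2) n - 1 := by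
      rw [hcast, hsucc, add_sub_cancel_right]
    have hp1 : (Fin.last n).castSucc + 1 = Fin.ofNat (n + 2) (n + 2) - 1 := by
      rw [hcast, hsucc (n + 1), sub_add_cancel, add_sub_cancel_right]
    have hdel := DS_erase_last_edge n _ _ ih
    rw [← hren] at hdel
    rw [hdel, hm1, hp1] at hend
    have hend' : 2 * a (n + 1) = a n + a (n + 2) + ((n + 2) * n.factorial : ℕ) := by
      rw [← hend, hcast]
    rw [hlast (n + 2) (by simp)] at hend'
    push_cast at hend'
    have hne : ((n : FractionRing (MvPolynomial (Fin (n + 2)) K)) + 2) ≠ 0 := by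
      exact_mod_cast (by omega : n + 2 ≠ 0)
    have ha1 : a 1 = n.factorial := by
      refine mul_left_cancel₀ hne ?_
      linear_combination hend' - 2 * h2 + h1
    rw [Fin.prod_univ_castSucc, mul_comm, hcast]
    change a (n + 1) = _
    rw [h2, ha1, Nat.factorial_succ]
    push_cast
    ring

theorem Fin.add_ofNat_succ {n : ℕ} (k : Fin (n + 1)) (r : ℕ) :
    k + Fin.ofNat (n + 1) (r + 1) = k + 1 + Fin.ofNat (n + 1) r := by
  have : Fin.ofNat (n + 1) (r + 1) = 1 + Fin.ofNat (n + 1) r := by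
    ext
    simp [Fin.val_add, Nat.add_comm]
  rw [this, add_assoc]

theorem exists_eq_zero_of_sum_eq {n : ℕ} (c : Fin (n + 1) → ℕ) (hc : ∑ j, c j = n) :
    ∃ z, c z = 0 := by
  by_contra! h
  have := (Finset.card_nsmul_le_sum Finset.univ c 1 fun j _ =>
    Nat.one_le_iff_ne_zero.mpr (h j)).trans_eq hc
  simp only [Finset.card_univ, Fintype.card_fin, smul_eq_mul, mul_one] at this
  omega

/-- Maximum principle for functions on the configurations of `n` chips on a cycle of `n + 1`
sites: a function harmonic for the moves splitting a pair of chips at one site is nonpositive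
if it is nonpositive on the configurations without such pairs. -/
theorem chip_configuration_le_zero {n : ℕ} (f : (Fin (n + 1) → ℕ) → ℚ)
    (hf : ∀ (d : Fin (n + 1) → ℕ) (k : Fin (n + 1)), ∑ j, d j + 2 = n →
      2 * f (d + Pi.single k 1 + Pi.single k 1) =
        f (d + Pi.single k 1 + Pi.single (k - 1) 1) +
          f (d + Pi.single k 1 + Pi.single (k + 1) 1))
    (h0 : ∀ c : Fin (n + 1) → ℕ, ∑ j, c j = n → (∀ j, c j ≤ 1) → f c ≤ 0)
    (c : Fin (n + 1) → ℕ) (hc : ∑ j, c j = n) : f c ≤ 0 := by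
  classical
  have hmem : ∀ {c : Fin (n + 1) → ℕ},
      c ∈ Finset.piAntidiag Finset.univ n ↔ ∑ j, c j = n := by
    intro c
    simp [Finset.mem_piAntidiag]
  obtain ⟨c₀, hc₀, hmax⟩ := Finset.exists_max_image (Finset.piAntidiag Finset.univ n) f
    ⟨c, hmem.mpr hc⟩
  let occ : (Fin (n + 1) → ℕ) → ℕ := fun c => (Finset.univ.filter fun j => c j ≠ 0).card
  obtain ⟨c₁, hc₁, hocc⟩ := Finset.exists_max_image
    ((Finset.piAntidiag Finset.univ n).filter fun c => f c = f c₀) occ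
    ⟨c₀, Finset.mem_filter.mpr ⟨hc₀, rfl⟩⟩
  simp only [Finset.mem_filter, hmem, and_imp] at hmax hc₁ hocc
  have hspread : ∀ (r : ℕ) (k : Fin (n + 1)) (c : Fin (n + 1) → ℕ), ∑ j, c j = n →
      f c = f c₀ → occ c = occ c₁ → 2 ≤ c k → c (k + Fin.ofNat (n + 1) r) ≠ 0 := by
    intro r
    induction r with
    | zero =>
      intro k c _ _ _ hk
      have : k + Fin.ofNat (n + 1) 0 = k := add_zero k
      rw [this]
      omega
    | succ r ih =>
      intro k c hsum hfc hoccc hk hz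
      let d : Fin (n + 1) → ℕ := fun j => if j = k then c k - 2 else c j
      have hcd : c = d + Pi.single k 1 + Pi.single k 1 := by
        ext j
        by_cases hj : j = k
        · subst hj
          simp only [d, Pi.add_apply, Pi.single_eq_same, if_true]
          omega
        · simp [d, hj]
      have hsums : ∀ l, ∑ j, (d + Pi.single k 1 + Pi.single l 1 : Fin (n + 1) → ℕ) j =
          ∑ j, d j + 2 := fun l => by
        simp [Finset.sum_add_distrib, add_assoc]
      have hd : ∑ j, d j + 2 = n := by
        rw [← hsums k, ← hcd, hsum]
      set c' : Fin (n + 1) → ℕ := d + Pi.single k 1 + Pi.single (k + 1) 1 with hc'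
      have hfc' : f c' = f c₀ := by
        have h1 := hf d k hd
        have h2 := hmax _ ((hsums (k - 1)).trans hd)
        have h3 := hmax c' ((hsums (k + 1)).trans hd)
        rw [← hcd, hfc] at h1
        linarith
      have hsum' : ∑ j, c' j = n := (hsums (k + 1)).trans hd
      have hval : ∀ j, c' j + (if j = k then 1 else 0) = c j + (if j = k + 1 then 1 else 0) := by
        intro j
        rw [hcd]
        simp only [hc', Pi.add_apply, Pi.single_apply]
        omega
      have hle := hocc c' hsum' hfc'
      by_cases hk1 : c (k + 1) = 0
      · have hlt : occ c < occ c' := by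
          refine Finset.card_lt_card (Finset.ssubset_iff_of_subset ?_ |>.mpr ⟨k + 1, ?_, ?_⟩)
          · intro j
            simp only [Finset.mem_filter, Finset.mem_univ, true_and]
            intro hj
            have := hval j
            by_cases hjk : j = k
            · subst hjk
              simp only [if_true] at this
              omega
            · simp only [hjk, if_false] at this
              omega
          · have hne : k + 1 ≠ k := fun h => by rw [h] at hk1; omega
            have := hval (k + 1)
            simp only [hne, if_false, if_true] at this
            simp only [Finset.mem_filter, Finset.mem_univ, true_and]
            omega
          · simp [hk1]
        omega
      · have hsame : occ c' = occ c := by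
          refine congrArg Finset.card (Finset.filter_congr fun j _ => not_congr ?_)
          have := hval j
          by_cases hjk : j = k
          · subst hjk
            simp only [if_true] at this
            omega
          · by_cases hjk1 : j = k + 1
            · subst hjk1
              simp only [hjk, if_false, if_true] at this
              omega
            · simp only [hjk, hjk1, if_false] at this
              omega
        have hk2 : 2 ≤ c' (k + 1) := by
          have := hval (k + 1)
          by_cases hjk : k + 1 = k
          · simp only [hjk, if_true] at this ⊢
            omega
          · simp only [hjk, if_false, if_true] at this
            omega
        refine ih (k + 1) c' hsum' hfc' (hsame.trans hoccc) hk2 ?_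
        rw [← Fin.add_ofNat_succ]
        have := hval (k + Fin.ofNat (n + 1) (r + 1))
        have hz1 : k + Fin.ofNat (n + 1) (r + 1) ≠ k + 1 := fun h => hk1 (h ▸ hz)
        simp only [hz1, if_false] at this
        omega
  have hle1 : ∀ j, c₁ j ≤ 1 := by
    intro k
    by_contra! hk
    obtain ⟨z, hz⟩ := exists_eq_zero_of_sum_eq c₁ hc₁.1
    refine hspread (z - k).val k c₁ hc₁.1 hc₁.2 rfl hk ?_
    rwa [Fin.ofNat_val_eq_self, add_sub_cancel]
  exact (hmax c hc).trans (hc₁.2 ▸ h0 c₁ hc₁.1 hle1)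

/-- A function on the configurations of `n` chips on a cycle of `n + 1` sites that is harmonic
for the moves splitting a pair of chips at one site is constant if it is constant on the
configurations without such pairs. -/
theorem chip_configuration_eq {L : Type*} [Field L] [CharZero L] {n : ℕ}
    (f : (Fin (n + 1) → ℕ) → L) (a : L)
    (hf : ∀ (d : Fin (n + 1) → ℕ) (k : Fin (n + 1)), ∑ j, d j + 2 = n →
      2 * f (d + Pi.single k 1 + Pi.single k 1) =
        f (d + Pi.single k 1 + Pi.single (k - 1) 1) +
          f (d + Pi.single k 1 + Pi.single (k + 1) 1))
    (ha : ∀ c : Fin (n + 1) → ℕ, ∑ j, c j = n → (∀ j, c j ≤ 1) → f c = a)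
    (c : Fin (n + 1) → ℕ) (hc : ∑ j, c j = n) : f c = a := by
  refine sub_eq_zero.mp ((Module.forall_dual_apply_eq_zero_iff ℚ _).mp fun φ => ?_)
  have hlin : ∀ (d : Fin (n + 1) → ℕ) (k : Fin (n + 1)), ∑ j, d j + 2 = n →
      2 * φ (f (d + Pi.single k 1 + Pi.single k 1) - a) =
        φ (f (d + Pi.single k 1 + Pi.single (k - 1) 1) - a) +
          φ (f (d + Pi.single k 1 + Pi.single (k + 1) 1) - a) := by
    intro d k hd
    rw [two_mul, ← map_add, ← map_add]
    congr 1
    linear_combination hf d k hd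
  have hzero : ∀ c : Fin (n + 1) → ℕ, ∑ j, c j = n → (∀ j, c j ≤ 1) → φ (f c - a) = 0 := by
    intro c hc hc1
    rw [sub_eq_zero.mpr (ha c hc hc1), map_zero]
  refine le_antisymm
    (chip_configuration_le_zero (fun c => φ (f c - a)) hlin
      (fun c hc hc1 => (hzero c hc hc1).le) c hc)
    (neg_nonpos.mp (chip_configuration_le_zero (fun c => -φ (f c - a))
      (fun d k hd => ?_) (fun c hc hc1 => (neg_eq_zero.mpr (hzero c hc hc1)).le) c hc))
  linear_combination -hlin d k hd

theorem prod_pathY_pow_add_single {K : Type*} [Field K] (n : ℕ) (c : Fin (n + 1) → ℕ)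
    (k i : Fin (n + 1)) :
    ∏ j, pathY n K j ^ (c + Pi.single k 1 : Fin (n + 1) → ℕ) (j + i) =
      pathY n K (k - i) * ∏ j, pathY n K j ^ c (j + i) := by
  simp only [Pi.add_apply, pow_add, Finset.prod_mul_distrib, Pi.single_apply,
    ← eq_sub_iff_add_eq]
  rw [mul_comm, Finset.prod_eq_single (k - i)]
  · simp
  · intro j _ hj
    simp [hj]
  · simp

theorem totalDegree_prod_pathY_pow_le {K : Type*} [Field K] {ι : Type*} [Fintype ι] (n : ℕ)
    (s : ι → Fin (n + 1)) (c : ι → ℕ) :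
    (∏ j, pathY n K (s j) ^ c j).totalDegree ≤ ∑ j, c j :=
  (totalDegree_finsetProd _ _).trans <| Finset.sum_le_sum fun _ _ =>
    (totalDegree_pow _ _).trans <|
      (Nat.mul_le_mul_left _ (totalDegree_pathY_le n K _)).trans_eq (mul_one _)

theorem sum_comp_add_right {n : ℕ} (c : Fin (n + 1) → ℕ) (i : Fin (n + 1)) :
    ∑ j, c (j + i) = ∑ j, c j :=
  Equiv.sum_comp (Equiv.addRight i) c

/-- The sum of `Φ` over the cyclic shifts of `c`, for `c` with all entries at most one. -/
theorem sum_DS_pathEdges_of_le_one {K : Type*} [Field K] [CharZero K] (n : ℕ)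
    (c : Fin (n + 1) → ℕ) (hc : ∑ j, c j = n) (hc1 : ∀ j, c j ≤ 1) :
    ∑ i : Fin (n + 1), DS (pathEdges n) (∏ j : Fin (n + 1), pathY n K j ^ c (j + i)) =
      (n.factorial : FractionRing (MvPolynomial (Fin (n + 1)) K)) := by
  obtain ⟨z, hz⟩ := exists_eq_zero_of_sum_eq c hc
  have hone : ∀ j, j ≠ z → c j = 1 := by
    have h1 : ∑ j ∈ Finset.univ.erase z, c j = ∑ j ∈ Finset.univ.erase z, 1 := by
      rw [Finset.sum_erase _ hz, hc]
      simp
    intro j hj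
    exact (Finset.sum_eq_sum_iff_of_le fun i _ => hc1 i).mp h1 j (by simp [hj])
  have hlast : Fin.last n + (z + 1) = z := by
    rw [add_left_comm, Fin.last_add_one, add_zero]
  rw [Finset.sum_eq_single (z + 1)]
  · rw [← DS_pathEdges_prod_pathY, Fin.prod_univ_castSucc, hlast, hz, pow_zero, mul_one]
    congr 1
    refine Finset.prod_congr rfl fun j _ => ?_
    rw [hone, pow_one]
    intro h
    exact (Fin.castSucc_lt_last j).ne (add_right_cancel (h.trans hlast.symm))
  · intro i _ hi
    have h1 : c (Fin.last n + i) = 1 :=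
      hone _ fun h => hi (add_left_cancel (h.trans hlast.symm))
    have hsum := (sum_comp_add_right c i).trans hc
    rw [Fin.sum_univ_castSucc, h1] at hsum
    rw [Fin.prod_univ_castSucc, h1, pow_one, mul_comm]
    refine DS_pathEdges_pathY_last_mul _ _ ?_
    have := totalDegree_prod_pathY_pow_le (K := K) n Fin.castSucc
      fun j : Fin n => c (j.castSucc + i)
    omega
  · simp

/-- for the path `G` on `x_0, …, x_n`, `Φ = DS_G`, and
`y_i = x_0 + ⋯ + x_i`: for all nonnegative integers `c_0, …, c_n` with
`c_0 + ⋯ + c_n = n`, `Σ_{i=0}^{n} Φ(Π_{j=0}^{n} y_j^{c_{j+i}}) = n!`, the index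
`j + i` in `c` being taken modulo `n + 1`. -/
theorem sum_cyclic_divided_symmetrization {K : Type*} [Field K] [CharZero K] (n : ℕ)
    (c : Fin (n + 1) → ℕ) (hc : ∑ j, c j = n) :
    ∑ i : Fin (n + 1),
        DS (pathEdges n) (∏ j : Fin (n + 1), pathY n K j ^ c (j + i)) =
      (n.factorial : FractionRing (MvPolynomial (Fin (n + 1)) K)) := by
  let Ψ : (Fin (n + 1) → ℕ) → FractionRing (MvPolynomial (Fin (n + 1)) K) := fun c =>
    ∑ i : Fin (n + 1), DS (pathEdges n) (∏ j : Fin (n + 1), pathY n K j ^ c (j + i))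
  have hΨ : ∀ (d : Fin (n + 1) → ℕ) (k : Fin (n + 1)), ∑ j, d j + 2 = n →
      2 * Ψ (d + Pi.single k 1 + Pi.single k 1) =
        Ψ (d + Pi.single k 1 + Pi.single (k - 1) 1) +
          Ψ (d + Pi.single k 1 + Pi.single (k + 1) 1) := by
    intro d k hd
    simp only [Ψ, Finset.mul_sum, ← Finset.sum_add_distrib, prod_pathY_pow_add_single]
    refine Finset.sum_congr rfl fun i _ => ?_
    rw [sub_right_comm, ← sub_add_eq_add_sub]
    refine two_mul_DS_pathY_mul_pathY_mul n (k - i) _ ?_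
    have h1 := totalDegree_prod_pathY_pow_le (K := K) n id fun j => d (j + i)
    rw [sum_comp_add_right] at h1
    simp only [id] at h1
    omega
  exact chip_configuration_eq Ψ _ hΨ (sum_DS_pathEdges_of_le_one n) c hc
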